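/- Let n ≥ 1 and a₁,…,a_n > 0, and set μ = min(a₁,…,a_n). For every ε with 0 < ε < μ², as t → 0⁺ the Dirichlet heat trace of the box ∏_{j=1}^n [0,a_j] satisfies ∑_{m₁≥1}⋯∑_{m_n≥1} exp(−π²(m₁²/a₁² + ⋯ + m_n²/a_n²) t) = (1/2ⁿ)∏_{j=1}^n (a_j/√(πt) − 1) + O(e^{−(μ²−ε)/t}). -/

import Mathlib

open Real Filter Asymptotics
open scoped Topology BigOperators

theorem summable_exp_neg_mul_add_one_sq {c : ℝ} (hc : 0 < c) :
    Summable fun k : ℕ => exp (-c * ((k : ℝ) + 1) ^ 2) := by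
  have h := summable_exp_nat_mul_of_ge (neg_lt_zero.mpr hc)
    (f := fun k : ℕ => ((k : ℝ) + 1) ^ 2) fun k => by nlinarith [(k.cast_nonneg : (0 : ℝ) ≤ k)]
  simpa using h

theorem tsum_int_exp_neg_mul_sq {c : ℝ} (hc : 0 < c) :
    ∑' n : ℤ, exp (-c * (n : ℝ) ^ 2) = 1 + 2 * ∑' k : ℕ, exp (-c * ((k : ℝ) + 1) ^ 2) := by
  have hs := (summable_exp_neg_mul_add_one_sq hc).hasSum
  have h := HasSum.of_add_one_of_neg_add_one (f := fun n : ℤ => exp (-c * (n : ℝ) ^ 2))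
    (by simpa using hs)
    (by
      refine hs.congr_fun fun k => ?_
      push_cast
      ring_nf)
  rw [h.tsum_eq]
  simp
  ring

/-- The heat trace of the interval `[0, a]`, rewritten by Poisson summation. -/
theorem interval_heat_trace_eq {a t : ℝ} (ha : 0 < a) (ht : 0 < t) :
    ∑' k : ℕ, exp (-(π ^ 2 / a ^ 2 * t) * ((k : ℝ) + 1) ^ 2) =
      1 / 2 * (a / √(π * t) - 1) +
        a / √(π * t) * ∑' k : ℕ, exp (-(a ^ 2 / t) * ((k : ℝ) + 1) ^ 2) := by
  have h := Real.tsum_exp_neg_mul_int_sq (a := π * t / a ^ 2) (by positivity)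
  have h1 : -π * (π * t / a ^ 2) = -(π ^ 2 / a ^ 2 * t) := by ring
  have h2 : -π / (π * t / a ^ 2) = -(a ^ 2 / t) := by
    field_simp
  rw [h1, h2, tsum_int_exp_neg_mul_sq (by positivity), tsum_int_exp_neg_mul_sq (by positivity),
    ← sqrt_eq_rpow, sqrt_div' _ (by positivity), sqrt_sq ha.le, one_div_div] at h
  linarith

theorem hasSum_pi_prod_of_nonneg {n : ℕ} {f : Fin n → ℕ → ℝ} (h0 : ∀ j k, 0 ≤ f j k)
    (hf : ∀ j, Summable (f j)) :
    HasSum (fun m : Fin n → ℕ => ∏ j, f j (m j)) (∏ j, ∑' k, f j k) := by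
  induction n with
  | zero => simp
  | succ n ih =>
    have hS := ih (fun j => h0 j.succ) fun j => hf j.succ
    have hmul := (hf 0).mul_of_nonneg hS.summable (h0 0)
      fun m => Finset.prod_nonneg fun j _ => h0 j.succ (m j)
    have h := (hf 0).hasSum.mul hS hmul
    rw [Fin.prod_univ_succ, ← (Fin.consEquiv fun _ => ℕ).hasSum_iff]
    simpa [Function.comp_def, Fin.consEquiv, Fin.prod_univ_succ] using h

theorem div_sqrt_isBigO_exp (a : ℝ) {δ : ℝ} (hδ : 0 < δ) :
    (fun t : ℝ => a / √(π * t)) =O[𝓝[>] 0] fun t => exp (δ / t) := by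
  refine IsBigO.of_bound (|a| / δ) ?_
  filter_upwards [Ioc_mem_nhdsGT (zero_lt_one' ℝ)] with t ⟨ht, ht1⟩
  have h1 : t ≤ √(π * t) := le_sqrt_of_sq_le (by nlinarith [pi_gt_three])
  have h2 : δ / t ≤ exp (δ / t) := by linarith [add_one_le_exp (δ / t)]
  rw [norm_div, norm_of_nonneg (sqrt_nonneg _), norm_of_nonneg (exp_pos _).le, norm_eq_abs]
  calc |a| / √(π * t) ≤ |a| / t := by gcongr
    _ = |a| / δ * (δ / t) := by field_simp
    _ ≤ _ := by gcongr

theorem tsum_exp_neg_div_isBigO {c : ℝ} (hc : 0 < c) :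
    (fun t : ℝ => ∑' k : ℕ, exp (-(c / t) * ((k : ℝ) + 1) ^ 2)) =O[𝓝[>] 0]
      fun t => exp (-c / t) := by
  have hs := (summable_exp_neg_mul_add_one_sq hc).mul_right (exp c)
  refine IsBigO.of_bound (∑' k : ℕ, exp (-c * ((k : ℝ) + 1) ^ 2) * exp c) ?_
  filter_upwards [Ioc_mem_nhdsGT (zero_lt_one' ℝ)] with t ⟨ht, ht1⟩
  rw [norm_of_nonneg (tsum_nonneg fun _ => (exp_pos _).le), norm_of_nonneg (exp_pos _).le,
    ← tsum_mul_right]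
  refine (summable_exp_neg_mul_add_one_sq (by positivity)).tsum_le_tsum (fun k => ?_)
    (hs.mul_right _)
  rw [← exp_add, ← exp_add, exp_le_exp]
  have h1 : c ≤ c / t := le_div_self hc.le ht ht1
  have h2 : (0 : ℝ) ≤ ((k : ℝ) + 1) ^ 2 - 1 := by nlinarith [(k.cast_nonneg : (0 : ℝ) ≤ k)]
  rw [neg_div]
  nlinarith [mul_nonneg (sub_nonneg.2 h1) h2]

theorem isBigO_exp_div_of_le {b c : ℝ} (h : b ≤ c) :
    (fun t : ℝ => exp (b / t)) =O[𝓝[>] 0] fun t => exp (c / t) := by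
  refine IsBigO.of_bound 1 ?_
  filter_upwards [self_mem_nhdsWithin] with t (ht : 0 < t)
  rw [norm_of_nonneg (exp_pos _).le, norm_of_nonneg (exp_pos _).le, one_mul]
  gcongr

/-- Products of subexponentially growing functions differ by an exponentially small amount as soon
as the corresponding factors do. -/
theorem prod_sub_prod_isBigO_exp {ι : Type*} (s : Finset ι) {f g : ι → ℝ → ℝ} {c : ℝ} (hc : 0 ≤ c)
    (hg : ∀ j, ∀ δ > 0, g j =O[𝓝[>] 0] fun t => exp (δ / t))
    (hfg : ∀ j, ∀ δ > 0, (fun t => f j t - g j t) =O[𝓝[>] 0] fun t => exp ((-c + δ) / t)) :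
    ∀ δ > 0, (fun t => ∏ j ∈ s, f j t - ∏ j ∈ s, g j t) =O[𝓝[>] 0]
      fun t => exp ((-c + δ) / t) := by
  have hprod : ∀ s : Finset ι, ∀ δ > 0,
      (fun t => ∏ j ∈ s, g j t) =O[𝓝[>] 0] fun t => exp (δ / t) := by
    intro s
    induction s using Finset.cons_induction with
    | empty =>
      intro δ hδ
      simpa using isBigO_exp_div_of_le hδ.le
    | cons i s hi ih =>
      intro δ hδ
      refine ((hg i _ (half_pos hδ)).mul (ih _ (half_pos hδ))).congr (fun t => ?_) fun t => ?_
      · rw [Finset.prod_cons]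
      · rw [← exp_add, ← add_div, add_halves]
  induction s using Finset.cons_induction with
  | empty =>
    intro δ _
    simpa using isBigO_zero (fun t : ℝ => exp ((-c + δ) / t)) (𝓝[>] 0)
  | cons i s hi ih =>
    intro δ hδ
    have hδ' := half_pos hδ
    have hf : f i =O[𝓝[>] 0] fun t => exp (δ / 2 / t) :=
      (((hfg i _ hδ').trans (isBigO_exp_div_of_le (by linarith))).add (hg i _ hδ')).congr_left
        fun t => sub_add_cancel _ _
    refine ((hf.mul (ih _ hδ')).add ?_).congr_left
      (f₁ := fun t => f i t * (∏ j ∈ s, f j t - ∏ j ∈ s, g j t) +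
        (f i t - g i t) * ∏ j ∈ s, g j t) ?_ |>.congr_right
      (g₁ := fun t => exp (δ / 2 / t) * exp ((-c + δ / 2) / t)) ?_
    · exact ((hfg i _ hδ').mul (hprod s _ hδ')).congr_right fun t => mul_comm _ _
    · intro t
      rw [Finset.prod_cons, Finset.prod_cons]
      ring
    · intro t
      rw [← exp_add, ← add_div]
      ring_nf

/-- **Short-time asymptotics of the Dirichlet heat trace of an `n`-dimensional Euclidean box.**
For the box `∏_{j=1}^n [0, a_j]` with `a_j > 0`, setting `μ = min_j a_j`, for every
`0 < ε < μ²`, as `t → 0⁺`: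
`∑_{m₁,…,m_n ≥ 1} exp(−π² t ∑_j m_j²/a_j²)
  = (1/2ⁿ) ∏_j (a_j/√(πt) − 1) + O(e^{−(μ²−ε)/t})`. -/
theorem box_dirichlet_heat_trace_asymptotics
    (n : ℕ) (hn : 1 ≤ n) (a : Fin n → ℝ) (ha : ∀ j, 0 < a j)
    (ε : ℝ) (hε : 0 < ε) (hεμ : ε < (⨅ j, a j) ^ 2) :
    (fun t : ℝ =>
      (∑' m : Fin n → ℕ,
          Real.exp (-(π ^ 2 * (∑ j, ((m j : ℝ) + 1) ^ 2 / (a j) ^ 2)) * t))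
        - (1 / 2 ^ n) * ∏ j, (a j / Real.sqrt (π * t) - 1))
      =O[𝓝[>] (0 : ℝ)]
    (fun t : ℝ => Real.exp (-((⨅ j, a j) ^ 2 - ε) / t)) := by
  set μ := ⨅ j, a j
  have : Nonempty (Fin n) := ⟨⟨0, hn⟩⟩
  have hμ : 0 ≤ μ := le_ciInf fun j => (ha j).le
  have hμa : ∀ j, μ ^ 2 ≤ a j ^ 2 := fun j =>
    pow_le_pow_left₀ hμ (ciInf_le (Set.finite_range a).bddBelow j) 2
  have hfg : ∀ j, ∀ δ > 0,
      (fun t => ∑' k : ℕ, exp (-(π ^ 2 / a j ^ 2 * t) * ((k : ℝ) + 1) ^ 2)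
        - 1 / 2 * (a j / √(π * t) - 1)) =O[𝓝[>] 0] fun t => exp ((-μ ^ 2 + δ) / t) := by
    intro j δ hδ
    refine (((div_sqrt_isBigO_exp (a j) hδ).mul
      ((tsum_exp_neg_div_isBigO (pow_pos (ha j) 2)).trans
        (isBigO_exp_div_of_le (neg_le_neg (hμa j)))))).congr' ?_ ?_
    · filter_upwards [self_mem_nhdsWithin] with t (ht : 0 < t)
      rw [interval_heat_trace_eq (ha j) ht, add_sub_cancel_left]
    · refine .of_forall fun t => ?_
      beta_reduce
      rw [← exp_add, ← add_div, add_comm]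
  have hg : ∀ j, ∀ δ > 0,
      (fun t => 1 / 2 * (a j / √(π * t) - 1)) =O[𝓝[>] 0] fun t => exp (δ / t) := by
    intro j δ hδ
    refine ((div_sqrt_isBigO_exp (a j) hδ).sub ?_).const_mul_left _
    simpa using isBigO_exp_div_of_le hδ.le
  refine (prod_sub_prod_isBigO_exp Finset.univ (sq_nonneg μ) hg hfg ε hε).congr' ?_ ?_
  · filter_upwards [self_mem_nhdsWithin] with t (ht : 0 < t)
    have hsum := hasSum_pi_prod_of_nonneg
      (f := fun (j : Fin n) (k : ℕ) => exp (-(π ^ 2 / a j ^ 2 * t) * ((k : ℝ) + 1) ^ 2))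
      (fun _ _ => (exp_pos _).le)
      fun j => summable_exp_neg_mul_add_one_sq (by have := ha j; positivity)
    rw [← hsum.tsum_eq, Finset.prod_mul_distrib, Finset.prod_const, Finset.card_univ,
      Fintype.card_fin, one_div_pow]
    congr 2 with m
    rw [← exp_sum, Finset.mul_sum, ← Finset.sum_neg_distrib, Finset.sum_mul]
    congr! 2 with j
    ring
  · refine .of_forall fun t => ?_
    ring_nf
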